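/- Let H be a complex Hilbert space (with inner product conjugate-linear in the first argument) and let K be a closed real-linear subspace of H that is standard, i.e. K ∩ iK = {0} and K + iK is dense in H. Then the symplectic complement K′ = {ψ ∈ H : Im⟨ψ, φ⟩ = 0 for all φ ∈ K} is also a standard real subspace of H: K′ ∩ iK′ = {0} and K′ + iK′ is dense in H. -/

import Mathlib

/-- The set `K + iK` of sums `ψ + iφ` with `ψ, φ ∈ K`. -/
def sumSet {H : Type*} [AddCommGroup H] [Module ℂ H] (K : Set H) : Set H :=
  {w : H | ∃ ψ ∈ K, ∃ φ ∈ K, w = ψ + (Complex.I : ℂ) • φ}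

/-- The symplectic complement `K′ = {ψ : Im⟨ψ, φ⟩ = 0 for all φ ∈ K}` (the inner
product being conjugate-linear in the first argument). -/
def sympCompl {H : Type*} [NormedAddCommGroup H] [InnerProductSpace ℂ H]
    (K : Set H) : Set H :=
  {ψ : H | ∀ φ ∈ K, (@inner ℂ H _ ψ φ).im = 0}

section SymplecticComplement

variable {H : Type*} [NormedAddCommGroup H] [InnerProductSpace ℂ H]

/-- The symplectic complement, bundled as a real submodule. -/
def sympComplSubmodule (K : Set H) : Submodule ℝ H where
  carrier := sympCompl K
  zero_mem' φ _ := by simp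
  add_mem' {ψ χ} hψ hχ φ hφ := by simp [hψ φ hφ, hχ φ hφ]
  smul_mem' c ψ hψ φ hφ := by
    rw [← Complex.coe_smul, inner_smul_left]
    simp [hψ φ hφ]

/-- The set `K + iK`, bundled as a real submodule. -/
def sumSubmodule (K : Submodule ℝ H) : Submodule ℝ H where
  carrier := sumSet (K : Set H)
  zero_mem' := ⟨0, K.zero_mem, 0, K.zero_mem, by simp⟩
  add_mem' := by
    rintro _ _ ⟨a, ha, b, hb, rfl⟩ ⟨c, hc, d, hd, rfl⟩
    exact ⟨a + c, K.add_mem ha hc, b + d, K.add_mem hb hd, by rw [smul_add]; abel⟩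
  smul_mem' := by
    rintro r _ ⟨a, ha, b, hb, rfl⟩
    exact ⟨r • a, K.smul_mem r ha, r • b, K.smul_mem r hb, by
      rw [smul_add, smul_comm r Complex.I b]⟩

/-- A vector in `K′ ∩ iK′` is orthogonal to `K`. -/
lemma inner_eq_zero_of_mem_sympCompl {K : Set H} {χ φ : H} (hχ : χ ∈ sympCompl K)
    (hiχ : Complex.I • χ ∈ sympCompl K) (hφ : φ ∈ K) : inner ℂ χ φ = 0 := by
  have hre := hiχ φ hφ
  rw [inner_smul_left] at hre
  exact Complex.ext (by simpa using hre) (hχ φ hφ)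

/-- If `K + iK` is dense, then `K′ ∩ iK′ = {0}`. -/
lemma eq_zero_of_mem_sympCompl_of_dense {K : Set H} (hdense : Dense (sumSet K)) {χ : H}
    (hχ : χ ∈ sympCompl K) (hiχ : Complex.I • χ ∈ sympCompl K) : χ = 0 := by
  refine hdense.eq_zero_of_inner_left ℂ ?_
  rintro _ ⟨ψ, hψ, φ, hφ, rfl⟩
  simp [inner_add_right, inner_smul_right, inner_eq_zero_of_mem_sympCompl hχ hiχ hψ,
    inner_eq_zero_of_mem_sympCompl hχ hiχ hφ]

open ClosedSubmodule in
/-- A vector which is complex orthogonal to the symplectic complement of a closed real subspace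
lies in that subspace. -/
lemma mem_of_inner_sympCompl_eq_zero [CompleteSpace H] {K : Submodule ℝ H}
    (hclosed : IsClosed (K : Set H)) {x : H}
    (hx : ∀ ψ ∈ sympCompl (K : Set H), inner ℂ ψ x = 0) : x ∈ K := by
  rw [← hclosed.submodule_topologicalClosure_eq, ← K.orthogonal_orthogonal_eq_closure,
    Submodule.mem_orthogonal]
  intro y hy
  have hiy : Complex.I • y ∈ sympCompl (K : Set H) := fun φ hφ ↦ by
    have h := K.inner_left_of_mem_orthogonal hφ hy
    rw [inner_real_eq_re_inner] at h
    simp [h]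
  have h := hx _ hiy
  rw [inner_smul_left] at h
  have h' : inner ℂ y x = 0 := by simpa using h
  rw [inner_real_eq_re_inner, h', Complex.zero_re]

open ClosedSubmodule in
/-- If `K` is closed and `K ∩ iK = {0}`, then `K′ + iK′` is dense. -/
lemma dense_sumSet_sympCompl [CompleteSpace H] {K : Submodule ℝ H}
    (hclosed : IsClosed (K : Set H))
    (hK : ∀ v ∈ K, (∃ φ ∈ K, v = Complex.I • φ) → v = 0) :
    Dense (sumSet (sympCompl (K : Set H))) := by
  change Dense (sumSubmodule (sympComplSubmodule (K : Set H)) : Set H)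
  rw [Submodule.dense_iff_topologicalClosure_eq_top, Submodule.topologicalClosure_eq_top_iff,
    Submodule.eq_bot_iff]
  intro x hx
  have horth : ∀ ψ ∈ sympCompl (K : Set H), inner ℂ ψ x = 0 := fun ψ hψ ↦ by
    have hre := Submodule.inner_right_of_mem_orthogonal
      (show ψ ∈ sumSubmodule (sympComplSubmodule (K : Set H)) from
        ⟨ψ, hψ, 0, (sympComplSubmodule (K : Set H)).zero_mem, by simp⟩) hx
    have him := Submodule.inner_right_of_mem_orthogonal
      (show Complex.I • ψ ∈ sumSubmodule (sympComplSubmodule (K : Set H)) from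
        ⟨0, (sympComplSubmodule (K : Set H)).zero_mem, ψ, hψ, by simp⟩) hx
    rw [inner_real_eq_re_inner] at hre him
    rw [inner_smul_left] at him
    exact Complex.ext hre (by simpa using him)
  have hxK : x ∈ K := mem_of_inner_sympCompl_eq_zero hclosed horth
  have hixK : Complex.I • x ∈ K := mem_of_inner_sympCompl_eq_zero hclosed fun ψ hψ ↦ by
    rw [inner_smul_right, horth ψ hψ, mul_zero]
  simpa using hK _ hixK ⟨x, hxK, rfl⟩

end SymplecticComplement

/-- In a complex Hilbert space `H`, if `K` is a closed standard
real-linear subspace (`K ∩ iK = {0}` and `K + iK` dense), then its symplectic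
complement `K′` is also standard: `K′ ∩ iK′ = {0}` and `K′ + iK′` is dense. -/
theorem sympCompl_standard_of_standard
    {H : Type*} [NormedAddCommGroup H] [InnerProductSpace ℂ H] [CompleteSpace H]
    (K : Submodule ℝ H)
    (hclosed : IsClosed (K : Set H))
    (hK : ∀ v ∈ K, (∃ φ ∈ K, v = (Complex.I : ℂ) • φ) → v = (0 : H))
    (hdense : Dense (sumSet (K : Set H))) :
    (∀ ψ ∈ sympCompl (K : Set H),
      (∃ χ ∈ sympCompl (K : Set H), ψ = (Complex.I : ℂ) • χ) → ψ = (0 : H)) ∧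
    Dense (sumSet (sympCompl (K : Set H))) := by
  refine ⟨?_, dense_sumSet_sympCompl hclosed hK⟩
  rintro _ hψ ⟨χ, hχ, rfl⟩
  rw [eq_zero_of_mem_sympCompl_of_dense hdense hχ hψ, smul_zero]
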